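/- Concentration of output measurements under pure differential privacy with respect to bounded trace distance: let k be a positive integer and τ = 1/k. Let A be a linear map on 2^n × 2^n complex matrices with A(I) = I (unital) that maps density matrices to density matrices, and suppose A is ε-differentially private with respect to τ-neighbouring states, i.e. for all density matrices ρ, σ with (1/2)·‖ρ − σ‖₁ ≤ τ one has A(ρ) ≤ e^ε·A(σ) in the Loewner order. Let O be the diagonal observable on ℂ^{2^n}, indexed by bit strings x ∈ {0,1}^n, with diagonal entry Σ_{i=1}^n (1 − 2x_i), and for a ≥ 0 let P_a be the diagonal projector with entry 1 exactly on those x with |Σ_{i=1}^n (1 − 2x_i)| ≥ a·n. Then for every density matrix ρ: Tr[P_a · A(ρ)] ≤ e^{k·ε} · 2^{−n} · #{ x ∈ {0,1}^n : |Σ_{i=1}^n (1 − 2x_i)| ≥ a·n }. -/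

import Mathlib

open scoped ComplexOrder

/-- Trace norm of a Hermitian matrix: the sum of the absolute values of its
eigenvalues (junk value `0` if not Hermitian). -/
noncomputable def traceNorm {d : Type*} [Fintype d] [DecidableEq d]
    (X : Matrix d d ℂ) : ℝ :=
  if h : X.IsHermitian then ∑ i, |h.eigenvalues i| else 0

/-- The eigenvalue of the observable `O = Σᵢ Zᵢ` on the computational basis state
indexed by the bit string `x ∈ {0,1}ⁿ`. -/
def zSum {n : ℕ} (x : Fin n → Bool) : ℝ :=
  ∑ i, (1 - 2 * (if x i then (1 : ℝ) else 0))

/-- A Hermitian matrix bounded below by `-c`, with `0 ≤ c`, has trace norm at most its trace plus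
`2 * c` times the dimension. -/
theorem traceNorm_le_of_posSemidef_add {d : Type*} [Fintype d] [DecidableEq d]
    {X : Matrix d d ℂ} (hX : X.IsHermitian) {c : ℝ} (hc : 0 ≤ c)
    (h : (X + (c : ℂ) • (1 : Matrix d d ℂ)).PosSemidef) :
    traceNorm X ≤ X.trace.re + 2 * c * Fintype.card d := by
  have hev : ∀ i, 0 ≤ hX.eigenvalues i + c := by
    intro i
    have h1 := h.dotProduct_mulVec_nonneg (hX.eigenvectorBasis i).ofLp
    have h2 : star (hX.eigenvectorBasis i).ofLp ⬝ᵥ (hX.eigenvectorBasis i).ofLp = 1 := by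
      have := hX.eigenvectorBasis.inner_eq_one i
      rw [EuclideanSpace.inner_eq_star_dotProduct] at this
      rwa [dotProduct_comm]
    rw [Matrix.add_mulVec, hX.mulVec_eigenvectorBasis, Matrix.smul_mulVec, Matrix.one_mulVec,
      dotProduct_add, dotProduct_smul, dotProduct_smul, h2] at h1
    have h3 := (Complex.le_def.1 h1).1
    simpa using h3
  have htr : X.trace.re = ∑ i, hX.eigenvalues i := by
    rw [hX.trace_eq_sum_eigenvalues]
    simp
  have hle : ∑ i, |hX.eigenvalues i| ≤ ∑ i, (hX.eigenvalues i + 2 * c) :=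
    Finset.sum_le_sum fun i _ => abs_le.2 ⟨by linarith [hev i], by linarith⟩
  rw [traceNorm, dif_pos hX, htr]
  refine hle.trans_eq ?_
  rw [Finset.sum_add_distrib, Finset.sum_const, Finset.card_univ, nsmul_eq_mul]
  ring

/-- Iterating a Loewner bound along a chain. -/
theorem posSemidef_exp_smul_sub_of_chain {d : Type*} (B : ℕ → Matrix d d ℂ) (ε : ℝ) (k : ℕ)
    (h : ∀ j < k, (((Real.exp ε : ℝ) : ℂ) • B (j + 1) - B j).PosSemidef) :
    (((Real.exp (k * ε) : ℝ) : ℂ) • B k - B 0).PosSemidef := by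
  induction k with
  | zero => simpa using Matrix.PosSemidef.zero
  | succ k ih =>
    have h1 := ih fun j hj => h j (hj.trans k.lt_succ_self)
    have h2 := (h k k.lt_succ_self).smul
      (show (0 : ℂ) ≤ ((Real.exp (k * ε) : ℝ) : ℂ) from
        Complex.zero_le_real.2 (Real.exp_pos _).le)
    convert h2.add h1 using 1
    rw [smul_sub, smul_smul, ← Complex.ofReal_mul, ← Real.exp_add]
    have : (((k + 1 : ℕ) : ℝ)) * ε = k * ε + ε := by push_cast; ring
    rw [this]
    abel

/-- The real part of the trace against a diagonal indicator is a sum of diagonal entries. -/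
theorem re_trace_diagonal_indicator_mul {d : Type*} [Fintype d] [DecidableEq d]
    (p : d → Prop) [DecidablePred p] (M : Matrix d d ℂ) :
    (Matrix.diagonal (fun x => if p x then (1 : ℂ) else 0) * M).trace.re =
      ∑ x ∈ Finset.univ.filter p, (M x x).re := by
  simp only [Matrix.trace, Matrix.diag_apply, Matrix.diagonal_mul, Complex.re_sum,
    Finset.sum_filter]
  refine Finset.sum_congr rfl fun x _ => ?_
  split_ifs <;> simp

/-- Concentration of output measurements under pure differential privacy with
respect to bounded trace distance. -/
theorem concentration_pure_DP_bounded_trace_distance {n : ℕ}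
    (k : ℕ) (hk : 0 < k) (τ : ℝ) (hτ : τ = 1 / k)
    (A : Matrix (Fin n → Bool) (Fin n → Bool) ℂ →ₗ[ℂ] Matrix (Fin n → Bool) (Fin n → Bool) ℂ)
    (hAunital : A 1 = 1)
    (hAstates : ∀ ρ : Matrix (Fin n → Bool) (Fin n → Bool) ℂ,
      ρ.PosSemidef → ρ.trace = 1 → (A ρ).PosSemidef ∧ (A ρ).trace = 1)
    (ε : ℝ) (hε : 0 ≤ ε)
    (hpriv : ∀ ρ σ : Matrix (Fin n → Bool) (Fin n → Bool) ℂ,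
      ρ.PosSemidef → ρ.trace = 1 → σ.PosSemidef → σ.trace = 1 →
      (1 / 2) * traceNorm (ρ - σ) ≤ τ →
      (((Real.exp ε : ℝ) : ℂ) • A σ - A ρ).PosSemidef)
    (a : ℝ) (ha : 0 ≤ a)
    (Pa : Matrix (Fin n → Bool) (Fin n → Bool) ℂ)
    (hPa : Pa = Matrix.diagonal (fun x => if a * n ≤ |zSum x| then (1 : ℂ) else 0))
    (ρ : Matrix (Fin n → Bool) (Fin n → Bool) ℂ)
    (hρ : ρ.PosSemidef) (hρt : ρ.trace = 1) :
    ((Pa * A ρ).trace).re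
      ≤ Real.exp (k * ε) * ((2 : ℝ) ^ n)⁻¹ *
          (Finset.univ.filter (fun x : Fin n → Bool => a * n ≤ |zSum x|)).card := by
  have hkc : (k : ℂ) ≠ 0 := by exact_mod_cast hk.ne'
  set c : ℝ := ((2 : ℝ) ^ n)⁻¹ with hc
  have hc0 : 0 ≤ c := by positivity
  have hcard : (Fintype.card (Fin n → Bool) : ℝ) = 2 ^ n := by simp
  have hccard : c * Fintype.card (Fin n → Bool) = 1 := by
    rw [hcard, hc]
    exact inv_mul_cancel₀ (by positivity)
  set μ : Matrix (Fin n → Bool) (Fin n → Bool) ℂ := (c : ℂ) • 1 with hμ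
  have hμp : μ.PosSemidef := Matrix.PosSemidef.one.smul (Complex.zero_le_real.2 hc0)
  have hμt : μ.trace = 1 := by
    rw [hμ, Matrix.trace_smul, Matrix.trace_one, smul_eq_mul]
    exact_mod_cast hccard
  let s : ℕ → Matrix (Fin n → Bool) (Fin n → Bool) ℂ := fun j =>
    ((1 - j / k : ℝ) : ℂ) • ρ + ((j / k : ℝ) : ℂ) • μ
  have hsp : ∀ j ≤ k, (s j).PosSemidef := by
    intro j hj
    have hj1 : (j : ℝ) / k ≤ 1 := div_le_one_of_le₀ (by exact_mod_cast hj) (by positivity)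
    exact (hρ.smul (Complex.zero_le_real.2 (by linarith))).add
      (hμp.smul (Complex.zero_le_real.2 (by positivity)))
  have hst : ∀ j, (s j).trace = 1 := by
    intro j
    simp only [s, Matrix.trace_add, Matrix.trace_smul, hρt, hμt, smul_eq_mul]
    push_cast
    ring
  have hstep : ∀ j, s j - s (j + 1) + ((c / k : ℝ) : ℂ) • 1 = ((1 / k : ℝ) : ℂ) • ρ := by
    intro j
    simp only [s, hμ]
    push_cast
    module
  have hchain := posSemidef_exp_smul_sub_of_chain (fun j => A (s j)) ε k (by
    intro j hj
    refine hpriv _ _ (hsp j hj.le) (hst j) (hsp (j + 1) hj) (hst (j + 1)) ?_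
    have hle := traceNorm_le_of_posSemidef_add (c := c / k)
      ((hsp j hj.le).isHermitian.sub (hsp (j + 1) hj).isHermitian) (by positivity)
      (by rw [hstep]; exact hρ.smul (Complex.zero_le_real.2 (by positivity)))
    rw [Matrix.trace_sub, hst, hst, sub_self, Complex.zero_re, zero_add] at hle
    have : 2 * (c / k) * Fintype.card (Fin n → Bool) = 2 * (1 / k) := by
      rw [← hccard]; ring
    rw [this] at hle
    rw [hτ]
    linarith)
  have hs0 : s 0 = ρ := by simp [s]
  have hsk : s k = μ := by simp [s, hkc]
  have hAμ : A μ = μ := by rw [hμ, map_smul, hAunital]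
  simp only [hs0, hsk, hAμ] at hchain
  rw [hPa, re_trace_diagonal_indicator_mul (fun x => a * n ≤ |zSum x|)]
  have hbound : ∀ x, (A ρ x x).re ≤ Real.exp (k * ε) * c := by
    intro x
    have h1 := (Complex.le_def.1 (hchain.diag_nonneg (i := x))).1
    simp only [hμ, Matrix.sub_apply, Matrix.smul_apply, Matrix.one_apply_eq, smul_eq_mul,
      mul_one, Complex.zero_re, Complex.sub_re, Complex.re_ofReal_mul, Complex.ofReal_re] at h1
    linarith
  refine (Finset.sum_le_card_nsmul _ _ _ fun x _ => hbound x).trans_eq ?_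
  rw [nsmul_eq_mul, mul_comm]
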